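/- If a hyperbolic quadric Q in PG(3,t^2) contains three pairwise skew lines all lying on the Hermitian surface X, then Q ∩ X consists of exactly 2(t+1) lines, t+1 from each of the two reguli of Q, and hence |Q ∩ X| = 2t^3 + t^2 + 1. -/

import Mathlib

open LinearAlgebra.Projectivization Projectivization Finset
open scoped Classical

/-- The Hermitian surface in `PG(3,q)`, `q = t²`. -/
def hermSurf (t : ℕ) (F : Type) [Field F] : Set (ℙ F (Fin 4 → F)) :=
  {x | ∑ i : Fin 4, (x.rep i) ^ (t + 1) = 0}

/-- The tangent plane to the Hermitian surface at a point `P`, given by the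
Hermitian polarity `∑ xᵢ · (Pᵢ)^t = 0`. -/
def hermTangentPlane (t : ℕ) (F : Type) [Field F] (P : ℙ F (Fin 4 → F)) :
    Set (ℙ F (Fin 4 → F)) :=
  {x | ∑ i : Fin 4, x.rep i * (P.rep i) ^ t = 0}

/-- The set of projective points of a linear subspace `W` (a plane if
`finrank W = 3`, a line if `finrank W = 2`). -/
def projSet (F : Type) [Field F] (W : Submodule F (Fin 4 → F)) : Set (ℙ F (Fin 4 → F)) :=
  {x | x.submodule ≤ W}

section FiniteFieldCounting

variable {F : Type} [Field F] [Fintype F] {t : ℕ}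

/-- In a field of order `t²` with `t` a prime power, `x ↦ x ^ t` is a ring homomorphism. -/
theorem exists_ringHom_pow_eq (ht : IsPrimePow t) (hF : Fintype.card F = t ^ 2) :
    ∃ σ : F →+* F, ∀ x, σ x = x ^ t := by
  obtain ⟨p, n, hp, hn, rfl⟩ := ht
  have hp' : p.Prime := hp.nat_prime
  obtain ⟨r, hr⟩ := CharP.exists F
  obtain ⟨m, hr', hm⟩ := FiniteField.card F r
  have hrp : r = p := by
    have h1 : r ∣ (p ^ n) ^ 2 := by
      rw [← hF, hm]
      exact dvd_pow_self r m.ne_zero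
    exact (Nat.prime_dvd_prime_iff_eq hr' hp').1
      (hr'.dvd_of_dvd_pow (hr'.dvd_of_dvd_pow h1))
  subst hrp
  have : ExpChar F r := ExpChar.prime hp'
  exact ⟨iterateFrobenius F r n, fun x => iterateFrobenius_def r n x⟩

open Polynomial in
/-- The equation `x ^ m = c` has `m` solutions in a finite field when `c` is an `m`-th power
by the obvious necessary criterion. -/
theorem card_filter_pow_eq {m k : ℕ} (hmk : m * k + 1 = Fintype.card F) {c : F}
    (hc : c ^ k = 1) : (univ.filter fun x : F => x ^ m = c).card = m := by
  have hm : m ≠ 0 := by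
    rintro rfl
    have := Fintype.one_lt_card (α := F)
    omega
  have hdvd : (X ^ m - C c : F[X]) ∣ X ^ Fintype.card F - X := by
    have h1 : (X ^ m - C c : F[X]) ∣ (X ^ m) ^ k - (C c) ^ k := sub_dvd_pow_sub_pow _ _ _
    rw [← C_pow, hc, ← pow_mul] at h1
    refine h1.trans ⟨X, ?_⟩
    rw [← hmk, pow_succ, C_1]
    ring
  have hroots := FiniteField.roots_X_pow_card_sub_X F
  have hne := FiniteField.X_pow_card_sub_X_ne_zero F (Fintype.one_lt_card (α := F))
  have hsplit : (X ^ Fintype.card F - X : F[X]).Splits := by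
    rw [splits_iff_card_roots, hroots,
      FiniteField.X_pow_card_sub_X_natDegree_eq F (Fintype.one_lt_card (α := F))]
    simp
  have hs := hsplit.of_dvd hne hdvd
  have hnd : (X ^ m - C c : F[X]).roots.Nodup := by
    refine Multiset.nodup_of_le (Polynomial.roots.le_of_dvd hne hdvd) ?_
    rw [hroots]
    exact univ.nodup
  have hmon : (X ^ m - C c : F[X]) ≠ 0 := X_pow_sub_C_ne_zero (Nat.pos_of_ne_zero hm) c
  have hcard := hs.natDegree_eq_card_roots
  rw [natDegree_X_pow_sub_C] at hcard
  refine Eq.trans ?_ ((Multiset.toFinset_card_of_nodup hnd).trans hcard.symm)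
  congr 1
  ext x
  simp [hmon, sub_eq_zero]

theorem card_filter_pow_eq_self (ht : 1 < t) (hF : Fintype.card F = t ^ 2) :
    (univ.filter fun x : F => x ^ t = x).card = t := by
  obtain ⟨s, rfl⟩ : ∃ s, t = s + 1 := ⟨t - 1, by omega⟩
  have h1 : (univ.filter fun x : F => x ^ s = 1).card = s :=
    card_filter_pow_eq (k := s + 2) (by rw [hF]; ring) (one_pow _)
  have h2 : (univ.filter fun x : F => x ^ (s + 1) = x)
      = insert 0 (univ.filter fun x : F => x ^ s = 1) := by
    ext x
    by_cases hx : x = 0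
    · simp [hx]
    · simp [hx, pow_succ]
  rw [h2, card_insert_of_notMem, h1]
  simp [show s ≠ 0 by omega]

theorem exists_pow_ne_self (ht : 1 < t) (hF : Fintype.card F = t ^ 2) :
    ∃ x : F, x ^ t ≠ x := by
  by_contra! h
  have := card_filter_pow_eq_self ht hF
  simp only [h, filter_true, card_univ, hF] at this
  nlinarith

/-- A nondegenerate diagonal skew-Hermitian form in two variables has `t + 1` isotropic points,
none of which is at infinity. -/
theorem card_filter_diagonal_eq_zero (ht : 1 < t) (hF : Fintype.card F = t ^ 2) {α γ : F}
    (hα : α ≠ 0) (hγ : γ ≠ 0) (hα' : α ^ t = -α) (hγ' : γ ^ t = -γ) :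
    (univ.filter fun x : F => α * x ^ (t + 1) + γ = 0).card = t + 1 := by
  obtain ⟨s, rfl⟩ : ∃ s, t = s + 1 := ⟨t - 1, by omega⟩
  have hs : ∀ z : F, z ≠ 0 → z ^ (s + 1) = -z → z ^ s = -1 := fun z hz h =>
    mul_right_cancel₀ hz (by rw [← pow_succ, h]; ring)
  have h1 : ((-γ / α : F)) ^ s = 1 := by
    have hm1 : ((-1 : F)) ^ s = 1 := by
      have h2 : ∀ z : F, z ≠ 0 → z ^ (s * (s + 2)) = 1 := fun z hz => by
        have := FiniteField.pow_card_sub_one_eq_one z hz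
        rwa [hF, show (s + 1) ^ 2 - 1 = s * (s + 2) by
          rw [show (s + 1) ^ 2 = s * (s + 2) + 1 by ring]; rfl] at this
      have h3 := h2 α hα
      rw [pow_mul, hs α hα hα'] at h3
      rw [pow_add] at h3
      simpa using h3
    rw [neg_div, neg_pow, div_pow, hs α hα hα', hs γ hγ hγ', hm1]
    simp
  refine Eq.trans ?_
    (card_filter_pow_eq (F := F) (m := s + 1 + 1) (k := s) (by rw [hF]; ring) h1)
  congr 1
  ext x
  simp only [mem_filter, mem_univ, true_and, eq_div_iff hα]
  constructor <;> intro h <;> linear_combination h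

end FiniteFieldCounting

section Lines

variable {F : Type} [Field F]

theorem rep_mem_iff_mem_projSet {W : Submodule F (Fin 4 → F)} {x : ℙ F (Fin 4 → F)} :
    x ∈ projSet F W ↔ x.rep ∈ W := by
  rw [projSet, Set.mem_ofPred_eq, Projectivization.submodule_eq,
    Submodule.span_singleton_le_iff_mem]

theorem mk_mem_projSet_iff {W : Submodule F (Fin 4 → F)} {v : Fin 4 → F} (hv : v ≠ 0) :
    Projectivization.mk F v hv ∈ projSet F W ↔ v ∈ W := by
  rw [projSet, Set.mem_ofPred_eq, Projectivization.submodule_mk,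
    Submodule.span_singleton_le_iff_mem]

variable {V : Type} [AddCommGroup V] [Module F V]

theorem finrank_span_pair {p q : V} (h : LinearIndependent F ![p, q]) :
    Module.finrank F (Submodule.span F {p, q}) = 2 := by
  rw [← Matrix.range_cons_cons_empty p q ![], finrank_span_eq_card h, Fintype.card_fin]

theorem eq_span_pair {W : Submodule F V} (hW : Module.finrank F W = 2) {p q : V}
    (hp : p ∈ W) (hq : q ∈ W) (h : LinearIndependent F ![p, q]) :
    W = Submodule.span F {p, q} := by
  have : FiniteDimensional F W := Module.finite_of_finrank_pos (by omega)
  refine (Submodule.eq_of_le_of_finrank_le ?_ ?_).symm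
  · rw [Submodule.span_le]
    rintro x (rfl | rfl) <;> assumption
  · rw [finrank_span_pair h, hW]

theorem eq_zero_of_inf_eq_bot {A B : Submodule F V} (h : A ⊓ B = ⊥) {x : V} (hA : x ∈ A)
    (hB : x ∈ B) : x = 0 :=
  (Submodule.mem_bot F).1 (h ▸ Submodule.mem_inf.2 ⟨hA, hB⟩)

theorem linearIndependent_pair_of_inf_eq_bot {A B : Submodule F V} (h : A ⊓ B = ⊥) {p q : V}
    (hp : p ∈ A) (hq : q ∈ B) (hp0 : p ≠ 0) (hq0 : q ≠ 0) : LinearIndependent F ![p, q] := by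
  rw [LinearIndependent.pair_iff]
  intro s r hsr
  have h1 : s • p = 0 := eq_zero_of_inf_eq_bot h (A.smul_mem s hp) (by
    rw [eq_neg_of_add_eq_zero_left hsr]
    exact B.neg_mem (B.smul_mem r hq))
  rw [h1, zero_add] at hsr
  exact ⟨(smul_eq_zero.1 h1).resolve_right hp0, (smul_eq_zero.1 hsr).resolve_right hq0⟩

/-- A basis of a two-dimensional subspace. -/
theorem exists_linearIndependent_pair {W : Submodule F V} (hW : Module.finrank F W = 2) :
    ∃ p ∈ W, ∃ q ∈ W, LinearIndependent F ![p, q] := by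
  have : FiniteDimensional F W := Module.finite_of_finrank_pos (by omega)
  let b := Module.finBasisOfFinrankEq F W hW
  refine ⟨b 0, (b 0).2, b 1, (b 1).2, ?_⟩
  have h := b.linearIndependent.map' W.subtype (Submodule.ker_subtype W)
  have hb : W.subtype ∘ b = ![(b 0 : V), (b 1 : V)] := by
    ext i
    fin_cases i <;> rfl
  rwa [hb] at h

/-- A line all of whose points are covered by both families of lines of a hyperbolic quadric
belongs to one of the families. -/
theorem mem_union_of_forall_mem {R R' : Finset (Submodule F V)}
    (hlines : ∀ W ∈ R ∪ R', Module.finrank F W = 2)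
    (hskew : ∀ W ∈ R, ∀ W' ∈ R, W ≠ W' → W ⊓ W' = ⊥)
    (hmeet : ∀ W ∈ R, ∀ W' ∈ R', W ⊓ W' ≠ ⊥) {L : Submodule F V}
    (hL : Module.finrank F L = 2) (hR : ∀ x ∈ L, x ≠ 0 → ∃ W ∈ R, x ∈ W)
    (hR' : ∀ x ∈ L, x ≠ 0 → ∃ W ∈ R', x ∈ W) : L ∈ R ∪ R' := by
  by_cases hLR : L ∈ R
  · exact mem_union_left _ hLR
  refine mem_union_right _ ?_
  obtain ⟨a, ha, b, hb, hab⟩ := exists_linearIndependent_pair hL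
  have hab' := LinearIndependent.pair_iff.1 hab
  have ha0 : a ≠ 0 := fun h => one_ne_zero (hab' 1 0 (by simp [h])).1
  have hb0 : b ≠ 0 := fun h => one_ne_zero (hab' 0 1 (by simp [h])).2
  have hc0 : a + b ≠ 0 := fun h => one_ne_zero (hab' 1 1 (by simpa using h)).1
  have key : ∀ A ∈ R, a ∈ A → b ∈ A → False := fun A hA haA hbA =>
    hLR (by
      rw [eq_span_pair hL ha hb hab,
        ← eq_span_pair (hlines A (mem_union_left _ hA)) haA hbA hab]
      exact hA)
  obtain ⟨A, hA, haA⟩ := hR a ha ha0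
  obtain ⟨A₂, hA₂, hbA₂⟩ := hR b hb hb0
  obtain ⟨A₃, hA₃, hcA₃⟩ := hR (a + b) (L.add_mem ha hb) hc0
  have h12 : A ⊓ A₂ = ⊥ := hskew A hA A₂ hA₂ fun h => key A hA haA (h ▸ hbA₂)
  have h13 : A ⊓ A₃ = ⊥ := hskew A hA A₃ hA₃ fun h =>
    key A hA haA (by simpa using A.sub_mem (h ▸ hcA₃ : a + b ∈ A) haA)
  have h23 : A₂ ⊓ A₃ = ⊥ := hskew A₂ hA₂ A₃ hA₃ fun h =>
    key A₂ hA₂ (by simpa using A₂.sub_mem (h ▸ hcA₃ : a + b ∈ A₂) hbA₂) hbA₂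
  obtain ⟨B, hB, haB⟩ := hR' a ha ha0
  obtain ⟨y, hy, hy0⟩ := Submodule.exists_mem_ne_zero_of_ne_bot (hmeet A₂ hA₂ B hB)
  obtain ⟨z, hz, hz0⟩ := Submodule.exists_mem_ne_zero_of_ne_bot (hmeet A₃ hA₃ B hB)
  rw [Submodule.mem_inf] at hy hz
  have hBspan := eq_span_pair (hlines B (mem_union_right _ hB)) haB hy.2
    (linearIndependent_pair_of_inf_eq_bot h12 haA hy.1 ha0 hy0)
  obtain ⟨c, d, hcd⟩ := Submodule.mem_span_pair.1 (hBspan ▸ hz.2)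
  have hc : c ≠ 0 := by
    rintro rfl
    rw [zero_smul, zero_add] at hcd
    exact hz0 (eq_zero_of_inf_eq_bot h23 (hcd ▸ A₂.smul_mem d hy.1) hz.1)
  have h0 : d • y - c • b = 0 := by
    refine eq_zero_of_inf_eq_bot h23 (A₂.sub_mem (A₂.smul_mem d hy.1) (A₂.smul_mem c hbA₂)) ?_
    have h1 : d • y - c • b = z - c • (a + b) := by rw [← hcd, smul_add]; abel
    rw [h1]
    exact A₃.sub_mem hz.1 (A₃.smul_mem c hcA₃)
  have hbB : b ∈ B := by
    rw [← inv_smul_smul₀ hc b, ← sub_eq_zero.1 h0]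
    exact B.smul_mem _ (B.smul_mem d hy.2)
  rw [eq_span_pair hL ha hb hab,
    ← eq_span_pair (hlines B (mem_union_right _ hB)) haB hbB hab]
  exact hB

end Lines

section HermitianForm

variable {F : Type} [Field F]

/-- The sesquilinear form `∑ xᵢ σ(yᵢ)`. -/
def hermForm (σ : F →+* F) : (Fin 4 → F) →ₗ[F] (Fin 4 → F) →ₛₗ[σ] F :=
  LinearMap.mk₂'ₛₗ (RingHom.id F) σ (fun x y => ∑ i, x i * σ (y i))
    (fun x x' y => by simp [add_mul, sum_add_distrib])
    (fun c x y => by simp [mul_sum, mul_assoc])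
    (fun x y y' => by simp [mul_add, sum_add_distrib])
    (fun c x y => by simp [mul_sum, mul_left_comm])

theorem hermForm_apply (σ : F →+* F) (x y : Fin 4 → F) :
    hermForm σ x y = ∑ i, x i * σ (y i) := rfl

theorem eq_zero_of_hermForm_eq_zero {σ : F →+* F} {x : Fin 4 → F}
    (h : ∀ y, hermForm σ x y = 0) : x = 0 := by
  ext i
  have := h (Pi.single i 1)
  rw [hermForm_apply, sum_eq_single i] at this
  · simpa using this
  · intro j _ hj
    simp [Pi.single_eq_of_ne hj]
  · simp

variable {t : ℕ} {σ : F →+* F}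

theorem mem_hermSurf_iff (hσ : ∀ x, σ x = x ^ t) (x : ℙ F (Fin 4 → F)) :
    x ∈ hermSurf t F ↔ hermForm σ x.rep x.rep = 0 := by
  simp only [hermSurf, Set.mem_ofPred_eq, hermForm_apply, hσ, pow_succ, mul_comm]

theorem mk_mem_hermSurf_iff (hσ : ∀ x, σ x = x ^ t) {x : Fin 4 → F} (hx : x ≠ 0) :
    Projectivization.mk F x hx ∈ hermSurf t F ↔ hermForm σ x x = 0 := by
  obtain ⟨a, ha⟩ := Projectivization.exists_smul_eq_mk_rep F x hx
  rw [mem_hermSurf_iff hσ, ← ha, Units.smul_def, map_smulₛₗ, LinearMap.map_smulₛₗ]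
  simp

theorem projSet_subset_hermSurf_iff (hσ : ∀ x, σ x = x ^ t) (W : Submodule F (Fin 4 → F)) :
    projSet F W ⊆ hermSurf t F ↔ ∀ x ∈ W, hermForm σ x x = 0 := by
  constructor
  · intro h x hx
    by_cases hx0 : x = 0
    · simp [hx0]
    exact (mk_mem_hermSurf_iff hσ hx0).1 (h ((mk_mem_projSet_iff hx0).2 hx))
  · intro h x hx
    exact (mem_hermSurf_iff hσ x).2 (h _ (rep_mem_iff_mem_projSet.1 hx))

variable [Fintype F]

theorem apply_apply_of_card (hF : Fintype.card F = t ^ 2) (hσ : ∀ x, σ x = x ^ t) (x : F) :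
    σ (σ x) = x := by
  rw [hσ, hσ, ← pow_mul, ← sq, ← hF, FiniteField.pow_card]

theorem hermForm_symm (hF : Fintype.card F = t ^ 2) (hσ : ∀ x, σ x = x ^ t)
    (x y : Fin 4 → F) : hermForm σ y x = σ (hermForm σ x y) := by
  simp only [hermForm_apply, map_sum, map_mul, apply_apply_of_card hF hσ, mul_comm]

/-- Polarization: a reflexive sesquilinear form vanishing on the diagonal of a subspace vanishes
identically on it. -/
theorem sesqForm_eq_zero_of_diag {V : Type} [AddCommGroup V] [Module F V] (ht : 1 < t)
    (hF : Fintype.card F = t ^ 2) (hσ : ∀ x, σ x = x ^ t) (B : V →ₗ[F] V →ₛₗ[σ] F) (ε : F)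
    {W : Submodule F V} (hB : ∀ x ∈ W, ∀ y ∈ W, B y x = ε * σ (B x y))
    (h0 : ∀ x ∈ W, B x x = 0) : ∀ x ∈ W, ∀ y ∈ W, B x y = 0 := by
  intro x hx y hy
  by_contra hb
  have key : ∀ z : F, z + ε * σ z = 0 := fun z => by
    have h1 := h0 ((z / B x y) • x + y) (W.add_mem (W.smul_mem _ hx) hy)
    simp only [map_add, map_smulₛₗ, LinearMap.add_apply, LinearMap.smul_apply, h0 x hx, h0 y hy,
      hB x hx y hy, smul_eq_mul, RingHom.id_apply, mul_zero, zero_add, add_zero] at h1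
    have hσb : σ (B x y) ≠ 0 := (map_ne_zero σ).2 hb
    rw [map_div₀] at h1
    field_simp at h1
    linear_combination h1
  have hε := key 1
  rw [map_one, mul_one] at hε
  obtain ⟨z, hz⟩ := exists_pow_ne_self ht hF
  apply hz
  have := key z
  rw [← hσ]
  linear_combination (-1 : F) * this + σ z * hε

/-- Coordinates adapted to three pairwise skew lines on the Hermitian surface. -/
theorem exists_adapted_basis (ht : 1 < t) (hF : Fintype.card F = t ^ 2)
    (hσ : ∀ x, σ x = x ^ t) {W₁ W₂ W₃ : Submodule F (Fin 4 → F)}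
    (h1 : Module.finrank F W₁ = 2) (h2 : Module.finrank F W₂ = 2)
    (h3 : Module.finrank F W₃ = 2) (h12 : W₁ ⊓ W₂ = ⊥) (h13 : W₁ ⊓ W₃ = ⊥) (h23 : W₂ ⊓ W₃ = ⊥)
    (i1 : ∀ x ∈ W₁, hermForm σ x x = 0) (i2 : ∀ x ∈ W₂, hermForm σ x x = 0)
    (i3 : ∀ x ∈ W₃, hermForm σ x x = 0) :
    ∃ (e₀ e₁ f₀ f₁ : Fin 4 → F) (α γ : F), α ≠ 0 ∧ γ ≠ 0 ∧ α ^ t = -α ∧ γ ^ t = -γ ∧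
      (∀ a b c d : F, a • e₀ + b • e₁ + c • f₀ + d • f₁ = 0 → a = 0 ∧ b = 0 ∧ c = 0 ∧ d = 0) ∧
      e₀ ∈ W₁ ∧ e₁ ∈ W₁ ∧ f₀ ∈ W₂ ∧ f₁ ∈ W₂ ∧ e₀ + f₀ ∈ W₃ ∧ e₁ + f₁ ∈ W₃ ∧
      ∀ u₀ u₁ w₀ w₁ : F, ∀ x, x = (w₀ * u₀) • e₀ + (w₀ * u₁) • e₁ + (w₁ * u₀) • f₀ +
        (w₁ * u₁) • f₁ → hermForm σ x x =
          (w₀ * w₁ ^ t - w₁ * w₀ ^ t) * (α * u₀ ^ (t + 1) + γ * u₁ ^ (t + 1)) := by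
  have hsymm := hermForm_symm hF hσ
  have iso : ∀ W : Submodule F (Fin 4 → F), (∀ x ∈ W, hermForm σ x x = 0) →
      ∀ x ∈ W, ∀ y ∈ W, hermForm σ x y = 0 := fun W hW =>
    sesqForm_eq_zero_of_diag ht hF hσ _ 1 (fun x _ y _ => by rw [one_mul, hsymm]) hW
  have compl : ∀ A B : Submodule F (Fin 4 → F), Module.finrank F A = 2 →
      Module.finrank F B = 2 → A ⊓ B = ⊥ → IsCompl A B := fun A B hA hB hAB =>
    (Submodule.isCompl_iff_disjoint _ _ (by simp [hA, hB])).2 (disjoint_iff.2 hAB)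
  have c23 := compl _ _ h2 h3 h23
  -- `φ` is the linear map from `W₁` to `W₂` whose graph is `W₃`.
  obtain ⟨φ, hφ2, hφ3, hφW⟩ : ∃ φ : (Fin 4 → F) →ₗ[F] (Fin 4 → F), (∀ x, φ x ∈ W₂) ∧
      (∀ x, x + φ x ∈ W₃) ∧ ∀ y ∈ W₂, ∃ x ∈ W₁, φ x = y := by
    refine ⟨-W₂.projection W₃ c23, fun x => ?_, fun x => ?_, fun y hy => ?_⟩
    · exact W₂.neg_mem (Submodule.projection_apply_mem c23 x)
    · simpa [sub_eq_add_neg] using Submodule.sub_projection_mem c23 x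
    · have : y ∈ W₁ ⊔ W₃ := (compl _ _ h1 h3 h13).sup_eq_top ▸ Submodule.mem_top
      obtain ⟨a, ha, b, hb, rfl⟩ := Submodule.mem_sup.1 this
      refine ⟨-a, W₁.neg_mem ha, ?_⟩
      have e1 := (Submodule.projection_apply_eq_zero_iff c23).2 hb
      have e2 := Submodule.projection_apply_of_mem_left c23 hy
      rw [map_add, e1, add_zero] at e2
      simp [e2]
  have hnd : ∀ x ∈ W₁, (∀ y ∈ W₁, hermForm σ x (φ y) = 0) → x = 0 := by
    intro x hx h
    apply eq_zero_of_hermForm_eq_zero (σ := σ)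
    intro y
    have : y ∈ W₁ ⊔ W₂ := (compl _ _ h1 h2 h12).sup_eq_top ▸ Submodule.mem_top
    obtain ⟨a, ha, b, hb, rfl⟩ := Submodule.mem_sup.1 this
    obtain ⟨c, hc, rfl⟩ := hφW b hb
    rw [map_add, iso W₁ i1 x hx a ha, h c hc, add_zero]
  have hskew : ∀ x ∈ W₁, ∀ y ∈ W₁, hermForm σ y (φ x) = -1 * σ (hermForm σ x (φ y)) := by
    intro x hx y hy
    have := iso W₃ i3 _ (hφ3 y) _ (hφ3 x)
    simp only [map_add, LinearMap.add_apply, iso W₁ i1 y hy x hx,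
      iso W₂ i2 _ (hφ2 y) _ (hφ2 x), hsymm x (φ y)] at this
    linear_combination this
  obtain ⟨e₀, he₀, hα⟩ : ∃ e ∈ W₁, hermForm σ e (φ e) ≠ 0 := by
    by_contra! h
    have := sesqForm_eq_zero_of_diag ht hF hσ ((hermForm σ).compl₂ φ) (-1) (W := W₁)
      (fun x hx y hy => by simpa using hskew x hx y hy) (fun x hx => by simpa using h x hx)
    obtain ⟨p, hp, q, hq, hpq⟩ := exists_linearIndependent_pair h1
    exact hpq.ne_zero 0 (hnd p hp fun y hy => by simpa using this p hp y hy)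
  have he₀0 : e₀ ≠ 0 := by
    rintro rfl
    simp at hα
  obtain ⟨a, ha, hae⟩ : ∃ a ∈ W₁, LinearIndependent F ![e₀, a] := by
    have hlt : ¬ W₁ ≤ Submodule.span F {e₀} := fun hle => by
      have := Submodule.finrank_mono hle
      rw [h1, finrank_span_singleton he₀0] at this
      omega
    obtain ⟨a, ha, hna⟩ := SetLike.not_le_iff_exists.1 hlt
    refine ⟨a, ha, ?_⟩
    rw [LinearIndependent.pair_iff' he₀0]
    exact fun c hc => hna (Submodule.mem_span_singleton.2 ⟨c, hc⟩)
  set k := hermForm σ a (φ e₀) / hermForm σ e₀ (φ e₀) with hk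
  set e₁ := a - k • e₀ with he₁
  have he₁W : e₁ ∈ W₁ := W₁.sub_mem ha (W₁.smul_mem k he₀)
  have h10 : hermForm σ e₁ (φ e₀) = 0 := by
    simp only [he₁, map_sub, map_smul, LinearMap.sub_apply, LinearMap.smul_apply, smul_eq_mul, hk]
    rw [div_mul_cancel₀ _ hα, sub_self]
  have h01 : hermForm σ e₀ (φ e₁) = 0 := by
    rw [hskew e₁ he₁W e₀ he₀, h10, map_zero, mul_zero]
  have hind : LinearIndependent F ![e₀, e₁] := by
    rw [LinearIndependent.pair_iff] at hae ⊢
    intro s r hsr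
    obtain ⟨h4, h5⟩ := hae (s - r * k) r (by
      rw [← hsr, he₁, smul_sub, sub_smul, mul_smul]; abel)
    subst h5
    simpa using h4
  have hγ : hermForm σ e₁ (φ e₁) ≠ 0 := by
    intro h
    refine hind.ne_zero 1 (hnd e₁ he₁W fun y hy => ?_)
    rw [eq_span_pair h1 he₀ he₁W hind, Submodule.mem_span_pair] at hy
    obtain ⟨c, d, rfl⟩ := hy
    simp [h10, h]
  have hα' : hermForm σ e₀ (φ e₀) ^ t = -hermForm σ e₀ (φ e₀) := by
    have := hskew e₀ he₀ e₀ he₀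
    rw [hσ] at this
    linear_combination this
  have hγ' : hermForm σ e₁ (φ e₁) ^ t = -hermForm σ e₁ (φ e₁) := by
    have := hskew e₁ he₁W e₁ he₁W
    rw [hσ] at this
    linear_combination this
  refine ⟨e₀, e₁, φ e₀, φ e₁, hermForm σ e₀ (φ e₀), hermForm σ e₁ (φ e₁), hα, hγ, hα', hγ',
    ?_, he₀, he₁W, hφ2 _, hφ2 _, hφ3 _, hφ3 _, ?_⟩
  · intro a b c d h
    have hab : a • e₀ + b • e₁ = 0 := by
      refine eq_zero_of_inf_eq_bot h12 (W₁.add_mem (W₁.smul_mem a he₀) (W₁.smul_mem b he₁W)) ?_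
      rw [add_assoc] at h
      rw [eq_neg_of_add_eq_zero_left h]
      exact W₂.neg_mem (W₂.add_mem (W₂.smul_mem c (hφ2 _)) (W₂.smul_mem d (hφ2 _)))
    have hcd : c • φ e₀ + d • φ e₁ = 0 := by
      rwa [hab, zero_add] at h
    have hcd' : c • e₀ + d • e₁ = 0 := by
      refine eq_zero_of_inf_eq_bot h13 (W₁.add_mem (W₁.smul_mem c he₀) (W₁.smul_mem d he₁W)) ?_
      have := hφ3 (c • e₀ + d • e₁)
      rwa [map_add, map_smul, map_smul, hcd, add_zero] at this
    obtain ⟨ha0, hb0⟩ := LinearIndependent.pair_iff.1 hind a b hab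
    obtain ⟨hc0, hd0⟩ := LinearIndependent.pair_iff.1 hind c d hcd'
    exact ⟨ha0, hb0, hc0, hd0⟩
  · rintro u₀ u₁ w₀ w₁ x rfl
    have z1 := fun y hy z hz => iso W₁ i1 y hy z hz
    have z2 := fun y z => iso W₂ i2 _ (hφ2 y) _ (hφ2 z)
    simp only [map_add, map_smulₛₗ, LinearMap.add_apply, LinearMap.smul_apply, z2,
      z1 e₀ he₀ e₀ he₀, z1 e₀ he₀ e₁ he₁W, z1 e₁ he₁W e₀ he₀, z1 e₁ he₁W e₁ he₁W, h01, h10,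
      hsymm e₀ (φ e₀), hsymm e₁ (φ e₀), hsymm e₀ (φ e₁), hsymm e₁ (φ e₁),
      zero_pow (show t ≠ 0 by omega),
      smul_eq_mul, RingHom.id_apply, map_mul, hσ, hα', hγ']
    ring

end HermitianForm

section Segre

theorem card_filter_option {β : Type} [Fintype β] (p : Option β → Prop) :
    (univ.filter p).card = (if p none then 1 else 0) + (univ.filter fun x => p (some x)).card := by
  simp only [card_filter, Fintype.sum_option]

variable {F : Type} [Field F]

/-- Normalized homogeneous coordinates of the points of the projective line. -/
def pgPoint : Option F → F × F
  | none => (1, 0)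
  | some x => (x, 1)

theorem exists_eq_mul_pgPoint {a b : F} (h : ¬ (a = 0 ∧ b = 0)) :
    ∃ c : F, ∃ o : Option F, c ≠ 0 ∧ a = c * (pgPoint o).1 ∧ b = c * (pgPoint o).2 := by
  by_cases hb : b = 0
  · exact ⟨a, none, fun ha => h ⟨ha, hb⟩, by simp [pgPoint], by simp [pgPoint, hb]⟩
  · exact ⟨b, some (a / b), hb, by simp [pgPoint, mul_div_cancel₀ _ hb], by simp [pgPoint]⟩

theorem pgPoint_ne (o : Option F) : ¬ ((pgPoint o).1 = 0 ∧ (pgPoint o).2 = 0) := by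
  cases o <;> simp [pgPoint]

variable {V : Type} [AddCommGroup V] [Module F V] {e₀ e₁ f₀ f₁ : V}

/-- The lines of one regulus of the hyperbolic quadric spanned by a basis `e₀, e₁, f₀, f₁`; the
lines of the complementary regulus are obtained by exchanging `e₁` and `f₀`. -/
def regulusLine (e₀ e₁ f₀ f₁ : V) (o : Option F) : Submodule F V :=
  Submodule.span F {(pgPoint o).1 • e₀ + (pgPoint o).2 • e₁,
    (pgPoint o).1 • f₀ + (pgPoint o).2 • f₁}

/-- A transversal of three lines of a regulus belongs to the complementary regulus. -/
theorem exists_eq_regulusLine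
    (hind : ∀ a b c d : F, a • e₀ + b • e₁ + c • f₀ + d • f₁ = 0 →
      a = 0 ∧ b = 0 ∧ c = 0 ∧ d = 0)
    {L : Submodule F V} (hL : Module.finrank F L = 2)
    (h₀ : regulusLine e₀ f₀ e₁ f₁ (none : Option F) ⊓ L ≠ ⊥)
    (h₁ : regulusLine e₀ f₀ e₁ f₁ (some (0 : F)) ⊓ L ≠ ⊥)
    (h₂ : regulusLine e₀ f₀ e₁ f₁ (some (1 : F)) ⊓ L ≠ ⊥) :
    ∃ o : Option F, regulusLine e₀ e₁ f₀ f₁ o = L := by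
  obtain ⟨p, hp, hp0⟩ := Submodule.exists_mem_ne_zero_of_ne_bot h₀
  obtain ⟨q, hq, hq0⟩ := Submodule.exists_mem_ne_zero_of_ne_bot h₁
  obtain ⟨r, hr, hr0⟩ := Submodule.exists_mem_ne_zero_of_ne_bot h₂
  simp only [Submodule.mem_inf, regulusLine, pgPoint, one_smul, zero_smul, zero_add, add_zero,
    Submodule.mem_span_pair] at hp hq hr
  obtain ⟨⟨x₀, x₁, rfl⟩, hpL⟩ := hp
  obtain ⟨⟨y₀, y₁, rfl⟩, hqL⟩ := hq
  obtain ⟨⟨z₀, z₁, rfl⟩, hrL⟩ := hr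
  have hx : ¬ (x₀ = 0 ∧ x₁ = 0) := by
    rintro ⟨rfl, rfl⟩
    simp at hp0
  have hy : ¬ (y₀ = 0 ∧ y₁ = 0) := by
    rintro ⟨rfl, rfl⟩
    simp at hq0
  have hLI : LinearIndependent F ![x₀ • e₀ + x₁ • e₁, y₀ • f₀ + y₁ • f₁] := by
    rw [LinearIndependent.pair_iff]
    intro s u hsu
    obtain ⟨k1, k2, k3, k4⟩ := hind (s * x₀) (s * x₁) (u * y₀) (u * y₁) (by
      rw [← hsu]; module)
    simp only [mul_eq_zero] at k1 k2 k3 k4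
    exact ⟨by_contra fun hs => hx ⟨k1.resolve_left hs, k2.resolve_left hs⟩,
      by_contra fun hu => hy ⟨k3.resolve_left hu, k4.resolve_left hu⟩⟩
  have hspan := eq_span_pair hL hpL hqL hLI
  rw [hspan, Submodule.mem_span_pair] at hrL
  obtain ⟨c, d, hcd⟩ := hrL
  obtain ⟨k1, k2, k3, k4⟩ := hind (c * x₀ - z₀) (c * x₁ - z₁) (d * y₀ - z₀) (d * y₁ - z₁) (by
    rw [← sub_eq_zero] at hcd
    rw [← hcd]; module)
  rw [sub_eq_zero] at k1 k2 k3 k4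
  have hz : ¬ (z₀ = 0 ∧ z₁ = 0) := by
    rintro ⟨rfl, rfl⟩
    simp at hr0
  have hc : c ≠ 0 := by
    rintro rfl
    exact hz ⟨by rw [← k1, zero_mul], by rw [← k2, zero_mul]⟩
  have hd : d ≠ 0 := by
    rintro rfl
    exact hz ⟨by rw [← k3, zero_mul], by rw [← k4, zero_mul]⟩
  obtain ⟨k, o, hk, hx₀, hx₁⟩ := exists_eq_mul_pgPoint hx
  refine ⟨o, ?_⟩
  have hy₀ : y₀ = (c * k / d) * (pgPoint o).1 := by
    rw [div_mul_eq_mul_div, eq_div_iff hd, mul_assoc, ← hx₀, k1, ← k3, mul_comm]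
  have hy₁ : y₁ = (c * k / d) * (pgPoint o).2 := by
    rw [div_mul_eq_mul_div, eq_div_iff hd, mul_assoc, ← hx₁, k2, ← k4, mul_comm]
  have hk' : c * k / d ≠ 0 := div_ne_zero (mul_ne_zero hc hk) hd
  have ep : (pgPoint o).1 • e₀ + (pgPoint o).2 • e₁ = k⁻¹ • (x₀ • e₀ + x₁ • e₁) := by
    rw [hx₀, hx₁, mul_smul, mul_smul, ← smul_add, inv_smul_smul₀ hk]
  have eq : (pgPoint o).1 • f₀ + (pgPoint o).2 • f₁ = (c * k / d)⁻¹ • (y₀ • f₀ + y₁ • f₁) := by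
    rw [hy₀, hy₁, mul_smul, mul_smul, ← smul_add, inv_smul_smul₀ hk']
  symm
  refine eq_span_pair hL ?_ ?_ ?_
  · rw [ep]
    exact L.smul_mem _ hpL
  · rw [eq]
    exact L.smul_mem _ hqL
  · rw [LinearIndependent.pair_iff]
    intro s u hsu
    obtain ⟨k1, k2, k3, k4⟩ := hind (s * (pgPoint o).1) (s * (pgPoint o).2) (u * (pgPoint o).1)
      (u * (pgPoint o).2) (by rw [← hsu]; module)
    simp only [mul_eq_zero] at k1 k2 k3 k4
    exact ⟨by_contra fun hs => pgPoint_ne o ⟨k1.resolve_left hs, k2.resolve_left hs⟩,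
      by_contra fun hu => pgPoint_ne o ⟨k3.resolve_left hu, k4.resolve_left hu⟩⟩

/-- A family of `q + 1` lines meeting three lines of a regulus is the complementary regulus. -/
theorem eq_image_regulusLine [Fintype F]
    (hind : ∀ a b c d : F, a • e₀ + b • e₁ + c • f₀ + d • f₁ = 0 →
      a = 0 ∧ b = 0 ∧ c = 0 ∧ d = 0)
    {R R' : Finset (Submodule F V)} (hcR' : R'.card = Fintype.card F + 1)
    (hlines : ∀ W ∈ R', Module.finrank F W = 2)
    (hmeet : ∀ W ∈ R, ∀ W' ∈ R', W ⊓ W' ≠ ⊥)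
    (h₀ : regulusLine e₀ f₀ e₁ f₁ (none : Option F) ∈ R)
    (h₁ : regulusLine e₀ f₀ e₁ f₁ (some (0 : F)) ∈ R)
    (h₂ : regulusLine e₀ f₀ e₁ f₁ (some (1 : F)) ∈ R) :
    R' = univ.image (regulusLine (F := F) e₀ e₁ f₀ f₁) ∧
      Function.Injective (regulusLine (F := F) e₀ e₁ f₀ f₁) := by
  have hsub : R' ⊆ univ.image (regulusLine (F := F) e₀ e₁ f₀ f₁) := fun L hL => by
    obtain ⟨o, ho⟩ := exists_eq_regulusLine hind (hlines L hL) (hmeet _ h₀ L hL)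
      (hmeet _ h₁ L hL) (hmeet _ h₂ L hL)
    exact mem_image.2 ⟨o, mem_univ o, ho⟩
  have hcard : (univ : Finset (Option F)).card = R'.card := by
    rw [hcR', card_univ, Fintype.card_option]
  have heq := eq_of_subset_of_card_le hsub (card_image_le.trans hcard.le)
  refine ⟨heq, ?_⟩
  have hinj := card_image_iff.1 ((congrArg card heq).symm.trans hcard.symm)
  rwa [coe_univ, Set.injOn_univ] at hinj

/-- The point of the hyperbolic quadric on given lines of the two reguli. -/
def segreVector (e₀ e₁ f₀ f₁ : V) (u w : F × F) : V :=
  (w.1 * u.1) • e₀ + (w.1 * u.2) • e₁ + (w.2 * u.1) • f₀ + (w.2 * u.2) • f₁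

theorem segreVector_swap (u w : F × F) :
    segreVector e₀ e₁ f₀ f₁ u w = segreVector e₀ f₀ e₁ f₁ w u := by
  simp only [segreVector]
  module

theorem mem_regulusLine_iff {o : Option F} {x : V} :
    x ∈ regulusLine e₀ e₁ f₀ f₁ o ↔ ∃ w, segreVector e₀ e₁ f₀ f₁ (pgPoint o) w = x := by
  rw [regulusLine, Submodule.mem_span_pair, Prod.exists]
  refine exists_congr fun a => exists_congr fun b => ?_
  rw [segreVector, ← sub_eq_zero, ← sub_eq_zero (a := _ + _)]
  refine Eq.congr ?_ rfl
  module

end Segre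

/-- The case where the three skew lines on the Hermitian surface are taken from the first
regulus. -/
theorem hermSurf_inter_quadric_of_three_lines_mem {t : ℕ} (ht : IsPrimePow t)
    {F : Type} [Field F] [Fintype F] (hF : Fintype.card F = t ^ 2)
    {R R' : Finset (Submodule F (Fin 4 → F))}
    (hcR : R.card = t ^ 2 + 1) (hcR' : R'.card = t ^ 2 + 1)
    (hlines : ∀ W ∈ R ∪ R', Module.finrank F W = 2)
    (hskewR : ∀ W ∈ R, ∀ W' ∈ R, W ≠ W' → W ⊓ W' = ⊥)
    (hskewR' : ∀ W ∈ R', ∀ W' ∈ R', W ≠ W' → W ⊓ W' = ⊥)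
    (hmeet : ∀ W ∈ R, ∀ W' ∈ R', W ⊓ W' ≠ ⊥)
    {Q : Set (ℙ F (Fin 4 → F))} (hQ : Q = ⋃ W ∈ R, projSet F W)
    (hQ' : Q = ⋃ W ∈ R', projSet F W)
    {W₁ W₂ W₃ : Submodule F (Fin 4 → F)} (hW₁ : W₁ ∈ R) (hW₂ : W₂ ∈ R) (hW₃ : W₃ ∈ R)
    (h12 : W₁ ⊓ W₂ = ⊥) (h13 : W₁ ⊓ W₃ = ⊥) (h23 : W₂ ⊓ W₃ = ⊥)
    (hX₁ : projSet F W₁ ⊆ hermSurf t F) (hX₂ : projSet F W₂ ⊆ hermSurf t F)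
    (hX₃ : projSet F W₃ ⊆ hermSurf t F) :
    (∃ R₀ ⊆ R, ∃ R₀' ⊆ R', R₀.card = t + 1 ∧ R₀'.card = t + 1 ∧
      (∀ W ∈ R₀ ∪ R₀', projSet F W ⊆ hermSurf t F) ∧
      Q ∩ hermSurf t F = ⋃ W ∈ R₀ ∪ R₀', projSet F W) ∧
    Nat.card ↥(Q ∩ hermSurf t F) = 2 * t ^ 3 + t ^ 2 + 1 := by
  obtain ⟨σ, hσ⟩ := exists_ringHom_pow_eq ht hF
  have ht1 : 1 < t := ht.one_lt
  have d : ∀ W ∈ R, Module.finrank F W = 2 := fun W hW => hlines W (mem_union_left _ hW)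
  rw [projSet_subset_hermSurf_iff hσ] at hX₁ hX₂ hX₃
  obtain ⟨e₀, e₁, f₀, f₁, α, γ, hα, hγ, hα', hγ', hind, he₀, he₁, hf₀, hf₁, hg₀, hg₁, hform⟩ :=
    exists_adapted_basis ht1 hF hσ (d _ hW₁) (d _ hW₂) (d _ hW₃) h12 h13 h23 hX₁ hX₂ hX₃
  have hind' : ∀ a b c d : F, a • e₀ + b • f₀ + c • e₁ + d • f₁ = 0 →
      a = 0 ∧ b = 0 ∧ c = 0 ∧ d = 0 := fun a b c d h => by
    obtain ⟨ha, hb, hc, hd⟩ := hind a c b d (by rw [← h]; abel)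
    exact ⟨ha, hc, hb, hd⟩
  have r₁ : regulusLine e₀ f₀ e₁ f₁ (none : Option F) = W₁ := by
    refine (eq_span_pair (d _ hW₁) ?_ ?_ ?_).symm
    · simpa [pgPoint] using he₀
    · simpa [pgPoint] using he₁
    · rw [LinearIndependent.pair_iff]
      intro s u h
      obtain ⟨hs, hu, -, -⟩ := hind s u 0 0 (by simpa [pgPoint] using h)
      exact ⟨hs, hu⟩
  have r₂ : regulusLine e₀ f₀ e₁ f₁ (some (0 : F)) = W₂ := by
    refine (eq_span_pair (d _ hW₂) ?_ ?_ ?_).symm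
    · simpa [pgPoint] using hf₀
    · simpa [pgPoint] using hf₁
    · rw [LinearIndependent.pair_iff]
      intro s u h
      obtain ⟨-, -, hs, hu⟩ := hind 0 0 s u (by simpa [pgPoint] using h)
      exact ⟨hs, hu⟩
  have r₃ : regulusLine e₀ f₀ e₁ f₁ (some (1 : F)) = W₃ := by
    refine (eq_span_pair (d _ hW₃) ?_ ?_ ?_).symm
    · simpa [pgPoint] using hg₀
    · simpa [pgPoint] using hg₁
    · rw [LinearIndependent.pair_iff]
      intro s u h
      obtain ⟨hs, hu, -, -⟩ := hind s u s u (by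
        rw [← h]
        simp only [pgPoint]
        module)
      exact ⟨hs, hu⟩
  obtain ⟨hR', hinj'⟩ := eq_image_regulusLine hind (hF ▸ hcR')
    (fun W hW => hlines W (mem_union_right _ hW)) hmeet (r₁.symm ▸ hW₁) (r₂.symm ▸ hW₂)
    (r₃.symm ▸ hW₃)
  have hmem' : ∀ o, regulusLine e₀ e₁ f₀ f₁ o ∈ R' := fun o =>
    hR' ▸ mem_image_of_mem _ (mem_univ o)
  obtain ⟨hR, hinj⟩ := eq_image_regulusLine hind' (hF ▸ hcR) d
    (fun W hW W' hW' => inf_comm W W' ▸ hmeet W' hW' W hW) (hmem' _) (hmem' _) (hmem' _)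
  have hmem : ∀ o, regulusLine e₀ f₀ e₁ f₁ o ∈ R := fun o =>
    hR ▸ mem_image_of_mem _ (mem_univ o)
  -- the two factors of the Hermitian form on the quadric
  set G : F × F → F := fun u => α * u.1 ^ (t + 1) + γ * u.2 ^ (t + 1) with hG
  set S : F × F → F := fun w => w.1 * w.2 ^ t - w.2 * w.1 ^ t with hS
  have hform' : ∀ u w, hermForm σ (segreVector e₀ e₁ f₀ f₁ u w) (segreVector e₀ e₁ f₀ f₁ u w) =
      S w * G u := fun u w => hform u.1 u.2 w.1 w.2 _ rfl
  have cardG : (univ.filter fun o : Option F => G (pgPoint o) = 0).card = t + 1 := by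
    rw [card_filter_option, ← card_filter_diagonal_eq_zero ht1 hF hα hγ hα' hγ']
    simp [hG, pgPoint, hα]
  have cardS : (univ.filter fun o : Option F => S (pgPoint o) = 0).card = t + 1 := by
    rw [card_filter_option, show (univ.filter fun x : F => S (pgPoint (some x)) = 0) =
      univ.filter fun x : F => x ^ t = x from filter_congr fun x _ => by
        simp [hS, pgPoint, sub_eq_zero, eq_comm], card_filter_pow_eq_self ht1 hF]
    simp [hS, pgPoint, show t ≠ 0 by omega, add_comm]
  have hne : ∀ o o' : Option F, segreVector e₀ e₁ f₀ f₁ (pgPoint o) (pgPoint o') ≠ 0 := by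
    intro o o' h
    obtain ⟨k1, k2, k3, k4⟩ := hind _ _ _ _ h
    have h1 := pgPoint_ne o
    have h2 := pgPoint_ne o'
    simp only [mul_eq_zero] at k1 k2 k3 k4
    by_cases hz : (pgPoint o).1 = 0
    · have hz2 : (pgPoint o).2 ≠ 0 := fun h => h1 ⟨hz, h⟩
      exact h2 ⟨k2.resolve_right hz2, k4.resolve_right hz2⟩
    · exact h2 ⟨k1.resolve_right hz, k3.resolve_right hz⟩
  set pt : Option F × Option F → ℙ F (Fin 4 → F) := fun x =>
    Projectivization.mk F _ (hne x.1 x.2) with hpt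
  have ptL' : ∀ o o', pt (o, o') ∈ projSet F (regulusLine e₀ e₁ f₀ f₁ o) := fun o o' =>
    (mk_mem_projSet_iff _).2 (mem_regulusLine_iff.2 ⟨_, rfl⟩)
  have ptL : ∀ o o', pt (o, o') ∈ projSet F (regulusLine e₀ f₀ e₁ f₁ o') := fun o o' =>
    (mk_mem_projSet_iff _).2 (mem_regulusLine_iff.2 ⟨_, (segreVector_swap _ _).symm⟩)
  have ptQ : ∀ x, pt x ∈ Q := fun x => by
    rw [hQ']
    exact Set.mem_biUnion (hmem' x.1) (ptL' x.1 x.2)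
  have ptX : ∀ x, pt x ∈ hermSurf t F ↔ G (pgPoint x.1) = 0 ∨ S (pgPoint x.2) = 0 := fun x => by
    rw [hpt, mk_mem_hermSurf_iff hσ, hform', mul_eq_zero, or_comm]
  have ptsurj : ∀ p ∈ Q, ∃ x, pt x = p := by
    intro p hp
    rw [hQ', Set.mem_iUnion₂] at hp
    obtain ⟨W, hW, hp⟩ := hp
    obtain ⟨o, -, rfl⟩ := mem_image.1 (hR' ▸ hW)
    obtain ⟨w, hw⟩ := mem_regulusLine_iff.1 (rep_mem_iff_mem_projSet.1 hp)
    have hw0 : ¬ (w.1 = 0 ∧ w.2 = 0) := fun h => by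
      apply p.rep_nonzero
      rw [← hw]
      simp [segreVector, h.1, h.2]
    obtain ⟨k, o', hk, h1, h2⟩ := exists_eq_mul_pgPoint hw0
    refine ⟨(o, o'), ?_⟩
    rw [← p.mk_rep, hpt, Projectivization.mk_eq_mk_iff']
    refine ⟨k⁻¹, ?_⟩
    rw [inv_smul_eq_iff₀ hk, ← hw]
    simp only [segreVector, h1, h2, smul_add, smul_smul, mul_assoc]
  have ptinj : Function.Injective pt := by
    rintro ⟨a, a'⟩ ⟨b, b'⟩ h
    have key : ∀ A B : Submodule F (Fin 4 → F), pt (a, a') ∈ projSet F A →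
        pt (a, a') ∈ projSet F B → A ⊓ B ≠ ⊥ := fun A B hA hB hAB =>
      (pt (a, a')).rep_nonzero (eq_zero_of_inf_eq_bot hAB (rep_mem_iff_mem_projSet.1 hA)
        (rep_mem_iff_mem_projSet.1 hB))
    have e1 : a = b := hinj' (by_contra fun hne =>
      key _ _ (ptL' a a') (h ▸ ptL' b b') (hskewR' _ (hmem' a) _ (hmem' b) hne))
    have e2 : a' = b' := hinj (by_contra fun hne =>
      key _ _ (ptL a a') (h ▸ ptL b b') (hskewR _ (hmem a') _ (hmem b') hne))
    rw [e1, e2]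
  constructor
  · refine ⟨(univ.filter fun o => S (pgPoint o) = 0).image (regulusLine e₀ f₀ e₁ f₁), ?_,
      (univ.filter fun o => G (pgPoint o) = 0).image (regulusLine e₀ e₁ f₀ f₁), ?_, ?_, ?_, ?_⟩
    · exact fun W hW => by
        obtain ⟨o, -, rfl⟩ := mem_image.1 hW
        exact hmem o
    · exact fun W hW => by
        obtain ⟨o, -, rfl⟩ := mem_image.1 hW
        exact hmem' o
    · rw [card_image_of_injective _ hinj, cardS]
    · rw [card_image_of_injective _ hinj', cardG]
    have hsub : ∀ W ∈ (univ.filter fun o => S (pgPoint o) = 0).image (regulusLine e₀ f₀ e₁ f₁) ∪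
        (univ.filter fun o => G (pgPoint o) = 0).image (regulusLine e₀ e₁ f₀ f₁),
        projSet F W ⊆ hermSurf t F := by
      intro W hW
      rw [projSet_subset_hermSurf_iff hσ]
      intro x hx
      rcases mem_union.1 hW with hW | hW <;> obtain ⟨o, ho, rfl⟩ := mem_image.1 hW <;>
        obtain ⟨w, rfl⟩ := mem_regulusLine_iff.1 hx
      · rw [segreVector_swap, hform', (mem_filter.1 ho).2, zero_mul]
      · rw [hform', (mem_filter.1 ho).2, mul_zero]
    refine ⟨hsub, Set.Subset.antisymm ?_ ?_⟩
    · rintro p ⟨hpQ, hpX⟩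
      obtain ⟨⟨o, o'⟩, rfl⟩ := ptsurj p hpQ
      rcases (ptX _).1 hpX with h | h
      · exact Set.mem_biUnion (mem_union_right _ (mem_image_of_mem _
          (mem_filter.2 ⟨mem_univ _, h⟩))) (ptL' o o')
      · exact Set.mem_biUnion (mem_union_left _ (mem_image_of_mem _
          (mem_filter.2 ⟨mem_univ _, h⟩))) (ptL o o')
    · refine Set.iUnion₂_subset fun W hW => Set.subset_inter ?_ (hsub W hW)
      rcases mem_union.1 hW with hW' | hW' <;> obtain ⟨o, -, rfl⟩ := mem_image.1 hW'
      · exact hQ ▸ Set.subset_biUnion_of_mem (u := projSet F) (hmem o)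
      · exact hQ' ▸ Set.subset_biUnion_of_mem (u := projSet F) (hmem' o)
  · have himage : Q ∩ hermSurf t F = ((univ.filter fun x : Option F × Option F =>
        G (pgPoint x.1) = 0 ∨ S (pgPoint x.2) = 0).image pt : Finset _) := by
      ext p
      simp only [coe_image, coe_filter, mem_univ, true_and, Set.mem_image, Set.mem_ofPred_eq]
      constructor
      · rintro ⟨hpQ, hpX⟩
        obtain ⟨x, rfl⟩ := ptsurj p hpQ
        exact ⟨x, (ptX x).1 hpX, rfl⟩
      · rintro ⟨x, hx, rfl⟩
        exact ⟨ptQ x, (ptX x).2 hx⟩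
    rw [himage, Nat.card_coe_set_eq, Set.ncard_coe_finset, card_image_of_injective _ ptinj]
    have c1 := card_filter_add_card_filter_not (s := (univ : Finset (Option F)))
      (fun o => G (pgPoint o) = 0)
    have c2 := card_filter_add_card_filter_not (s := (univ : Finset (Option F)))
      (fun o => S (pgPoint o) = 0)
    have c3 := card_filter_add_card_filter_not (s := (univ : Finset (Option F × Option F)))
      (fun x => G (pgPoint x.1) = 0 ∨ S (pgPoint x.2) = 0)
    have c4 : (univ.filter fun x : Option F × Option F =>
        ¬ (G (pgPoint x.1) = 0 ∨ S (pgPoint x.2) = 0)) =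
        (univ.filter fun o => ¬ G (pgPoint o) = 0) ×ˢ (univ.filter fun o => ¬ S (pgPoint o) = 0) := by
      ext x
      simp [not_or]
    rw [c4, card_product, card_univ, Fintype.card_prod, Fintype.card_option, hF] at c3
    rw [cardG, card_univ, Fintype.card_option, hF] at c1
    rw [cardS, card_univ, Fintype.card_option, hF] at c2
    zify at c1 c2 c3 ⊢
    rw [eq_sub_of_add_eq' c1, eq_sub_of_add_eq' c2] at c3
    linear_combination c3

/-- If a hyperbolic quadric `Q` in `PG(3,t²)` (given by its two complementary reguli
`R, R'`, each consisting of `q+1` pairwise skew lines, every line of `R` meeting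
every line of `R'`) contains three pairwise skew lines all lying on the Hermitian
surface `X`, then `Q ∩ X` consists of exactly `2(t+1)` lines, `t+1` from each
regulus, and hence `|Q ∩ X| = 2t³+t²+1`. -/
theorem hyperbolic_quadric_three_skew_lines (t : ℕ) (ht : IsPrimePow t)
    (F : Type) [Field F] [Fintype F] (hF : Fintype.card F = t ^ 2)
    (R R' : Finset (Submodule F (Fin 4 → F)))
    (hcR : R.card = t ^ 2 + 1) (hcR' : R'.card = t ^ 2 + 1)
    (hlines : ∀ W ∈ R ∪ R', Module.finrank F W = 2)
    (hskewR : ∀ W ∈ R, ∀ W' ∈ R, W ≠ W' → W ⊓ W' = ⊥)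
    (hskewR' : ∀ W ∈ R', ∀ W' ∈ R', W ≠ W' → W ⊓ W' = ⊥)
    (hmeet : ∀ W ∈ R, ∀ W' ∈ R', W ⊓ W' ≠ ⊥)
    (Q : Set (ℙ F (Fin 4 → F)))
    (hQ : Q = ⋃ W ∈ R, projSet F W) (hQ' : Q = ⋃ W ∈ R', projSet F W)
    (hthree : ∃ W₁ W₂ W₃ : Submodule F (Fin 4 → F),
      Module.finrank F W₁ = 2 ∧ Module.finrank F W₂ = 2 ∧ Module.finrank F W₃ = 2 ∧
      W₁ ⊓ W₂ = ⊥ ∧ W₁ ⊓ W₃ = ⊥ ∧ W₂ ⊓ W₃ = ⊥ ∧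
      projSet F W₁ ⊆ Q ∩ hermSurf t F ∧ projSet F W₂ ⊆ Q ∩ hermSurf t F ∧
      projSet F W₃ ⊆ Q ∩ hermSurf t F) :
    (∃ R₀ ⊆ R, ∃ R₀' ⊆ R', R₀.card = t + 1 ∧ R₀'.card = t + 1 ∧
      (∀ W ∈ R₀ ∪ R₀', projSet F W ⊆ hermSurf t F) ∧
      Q ∩ hermSurf t F = ⋃ W ∈ R₀ ∪ R₀', projSet F W) ∧
    Nat.card ↥(Q ∩ hermSurf t F) = 2 * t ^ 3 + t ^ 2 + 1 := by
  obtain ⟨W₁, W₂, W₃, d₁, d₂, d₃, h12, h13, h23, hX₁, hX₂, hX₃⟩ := hthree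
  have hmeet' : ∀ W ∈ R', ∀ W' ∈ R, W ⊓ W' ≠ ⊥ := fun W hW W' hW' =>
    inf_comm W W' ▸ hmeet W' hW' W hW
  have hcover : ∀ (T : Finset (Submodule F (Fin 4 → F))), Q = ⋃ W ∈ T, projSet F W →
      ∀ W, projSet F W ⊆ Q ∩ hermSurf t F → ∀ x ∈ W, x ≠ 0 → ∃ L ∈ T, x ∈ L := by
    intro T hT W hW x hx hx0
    have h1 := (hW ((mk_mem_projSet_iff hx0).2 hx)).1
    rw [hT, Set.mem_iUnion₂] at h1
    obtain ⟨L, hL, hxL⟩ := h1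
    exact ⟨L, hL, (mk_mem_projSet_iff hx0).1 hxL⟩
  have hmem : ∀ W : Submodule F (Fin 4 → F), Module.finrank F W = 2 →
      projSet F W ⊆ Q ∩ hermSurf t F → W ∈ R ∪ R' :=
    fun W hd hW => mem_union_of_forall_mem hlines hskewR hmeet hd (hcover R hQ W hW)
      (hcover R' hQ' W hW)
  have hX : ∀ {W}, projSet F W ⊆ Q ∩ hermSurf t F → projSet F W ⊆ hermSurf t F := fun h =>
    h.trans Set.inter_subset_right
  rcases mem_union.1 (hmem W₁ d₁ hX₁) with m₁ | m₁
  · have hside : ∀ W, W ∈ R ∪ R' → W₁ ⊓ W = ⊥ → W ∈ R := fun W hW h =>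
      (mem_union.1 hW).resolve_right fun hW' => hmeet W₁ m₁ W hW' h
    exact hermSurf_inter_quadric_of_three_lines_mem ht hF hcR hcR' hlines hskewR hskewR' hmeet hQ hQ'
      m₁ (hside W₂ (hmem W₂ d₂ hX₂) h12) (hside W₃ (hmem W₃ d₃ hX₃) h13) h12 h13 h23
      (hX hX₁) (hX hX₂) (hX hX₃)
  · have hside : ∀ W, W ∈ R ∪ R' → W₁ ⊓ W = ⊥ → W ∈ R' := fun W hW h =>
      (mem_union.1 hW).resolve_left fun hW' => hmeet' W₁ m₁ W hW' h
    obtain ⟨⟨R₀, hR₀, R₀', hR₀', c, c', hsub, heq⟩, hcard⟩ :=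
      hermSurf_inter_quadric_of_three_lines_mem ht hF hcR' hcR (union_comm R R' ▸ hlines) hskewR'
        hskewR hmeet' hQ' hQ m₁ (hside W₂ (hmem W₂ d₂ hX₂) h12)
        (hside W₃ (hmem W₃ d₃ hX₃) h13) h12 h13 h23 (hX hX₁) (hX hX₂) (hX hX₃)
    rw [union_comm R₀ R₀'] at hsub heq
    exact ⟨⟨R₀', hR₀', R₀, hR₀, c', c, hsub, heq⟩, hcard⟩
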